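/- The mapping class of the Reeb homeomorphism is not conjugate to that of its inverse: there is no orientation preserving homeomorphism Ψ of ℝ² with Ψ(ℤ₁) = ℤ₁ and Ψ(ℤ₂) = ℤ₂ such that Ψ∘R₀∘Ψ⁻¹ is isotopic to R₀⁻¹ relative to ℤ₁ ∪ ℤ₂. -/

import Mathlib

open Set

/-- The plane. -/
abbrev Plane : Type := ℝ × ℝ

/-- `f` is (the underlying function of) a homeomorphism of the plane. -/
def IsHomeoFun (f : Plane → Plane) : Prop :=
  ∃ e : Plane ≃ₜ Plane, ∀ x, e x = f x

/-- `g` and `g'` are isotopic relative to `O` : there is a continuous family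
`F (t, ·)`, `t ∈ [0,1]`, of homeomorphisms of the plane going from `g` to `g'`
and agreeing with `g` on `O` for all times. -/
def IsotopicRel (g g' : Plane → Plane) (O : Set Plane) : Prop :=
  ∃ F : ℝ × Plane → Plane, Continuous F ∧
    (∀ t ∈ Icc (0:ℝ) 1, IsHomeoFun fun x => F (t, x)) ∧
    (∀ x, F (0, x) = g x) ∧
    (∀ x, F (1, x) = g' x) ∧
    (∀ t ∈ Icc (0:ℝ) 1, ∀ x ∈ O, F (t, x) = g x)

/-- A homeomorphism of the plane is orientation preserving iff it is isotopic
to the identity. -/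
def OrientationPreserving (h : Plane ≃ₜ Plane) : Prop :=
  IsotopicRel id (⇑h) (∅ : Set Plane)

/-- A Brouwer homeomorphism: orientation preserving and fixed point free. -/
def IsBrouwer (h : Plane ≃ₜ Plane) : Prop :=
  OrientationPreserving h ∧ ∀ x, h x ≠ x

/-- The orbit of a point under a homeomorphism. -/
def horbit (h : Plane ≃ₜ Plane) (x : Plane) : Set Plane :=
  {y | ∃ n : ℤ, y = (h.toEquiv ^ n) x}

/-- `ℤ₁ = ℤ × {1}`. -/
def Z1 : Set Plane := {p | ∃ n : ℤ, p = ((n : ℝ), 1)}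

/-- `ℤ₂ = ℤ × {2}`. -/
def Z2 : Set Plane := {p | ∃ n : ℤ, p = ((n : ℝ), 2)}

/-- The shear homeomorphism `(x, y) ↦ (x + f y, y)`. -/
def shear (f : ℝ → ℝ) (hf : Continuous f) : Plane ≃ₜ Plane where
  toFun p := (p.1 + f p.2, p.2)
  invFun p := (p.1 - f p.2, p.2)
  left_inv p := by simp
  right_inv p := by simp
  continuous_toFun := (continuous_fst.add (hf.comp continuous_snd)).prodMk continuous_snd
  continuous_invFun := (continuous_fst.sub (hf.comp continuous_snd)).prodMk continuous_snd

/-- The translation `T (x, y) = (x + 1, y)`. -/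
def T : Plane ≃ₜ Plane := shear (fun _ => 1) continuous_const

/-- The twist `T₁ (x, y) = (x + 2 - y, y)`. -/
def T₁ : Plane ≃ₜ Plane := shear (fun y => 2 - y) (by continuity)

/-- The twist `T₂ (x, y) = (x + y - 1, y)`. -/
def T₂ : Plane ≃ₜ Plane := shear (fun y => y - 1) (by continuity)

/-- The model Reeb homeomorphism `R₀ = T₁ ∘ T₂⁻¹`, `R₀ (x, y) = (x + 3 - 2y, y)`. -/
def R₀ : Plane ≃ₜ Plane := shear (fun y => 3 - 2 * y) (by continuity)

/-- The Euclidean norm on the plane. -/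
noncomputable def planeNorm (p : Plane) : ℝ := Real.sqrt (p.1 ^ 2 + p.2 ^ 2)

/-- An angle function for a fixed point free map `h'` along a curve `γ`. -/
def IsAngleFunction (h' : Plane → Plane) (γ : ℝ → Plane) (θ : ℝ → ℝ) : Prop :=
  ContinuousOn θ (Icc 0 1) ∧
    ∀ t ∈ Icc (0:ℝ) 1,
      h' (γ t) - γ t =
        planeNorm (h' (γ t) - γ t) • (Real.cos (θ t), Real.sin (θ t))

/-- The conjugate `Φ ∘ h ∘ Φ⁻¹`. -/
def conjH (Φ h : Plane ≃ₜ Plane) : Plane ≃ₜ Plane := Φ.symm.trans (h.trans Φ)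

/-- An admissible straightening `Φ` for `(h, O₁, O₂)` : an orientation preserving
homeomorphism sending `O₁, O₂` to `ℤ₁, ℤ₂` such that `Φ ∘ h ∘ Φ⁻¹` is isotopic
relative to `ℤ₁ ∪ ℤ₂` to a homeomorphism translating each line `ℝ × {i}` by `±1`. -/
def AdmissibleStraightening (h : Plane ≃ₜ Plane) (O₁ O₂ : Set Plane)
    (Φ : Plane ≃ₜ Plane) : Prop :=
  OrientationPreserving Φ ∧ Φ '' O₁ = Z1 ∧ Φ '' O₂ = Z2 ∧
    ∃ ε₁ ε₂ : ℝ, (ε₁ = 1 ∨ ε₁ = -1) ∧ (ε₂ = 1 ∨ ε₂ = -1) ∧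
      ∃ g : Plane ≃ₜ Plane,
        (∀ x : ℝ, g (x, 1) = (x + ε₁, 1)) ∧
        (∀ x : ℝ, g (x, 2) = (x + ε₂, 2)) ∧
        IsotopicRel (⇑(conjH Φ h)) (⇑g) (Z1 ∪ Z2)

/-- A flow on the plane. -/
def IsFlow (φ : ℝ → Plane → Plane) : Prop :=
  Continuous (fun p : ℝ × Plane => φ p.1 p.2) ∧
    (∀ x, φ 0 x = x) ∧ ∀ s t x, φ (s + t) x = φ s (φ t x)

/-- A topological line in the plane: the image of a proper injective continuous
map from `ℝ` to the plane. -/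
def IsTopLine (L : Set Plane) : Prop :=
  ∃ f : ℝ → Plane, Continuous f ∧ Function.Injective f ∧ IsProperMap f ∧ range f = L

/-- The plane as the complex line. -/
noncomputable def toC : Plane ≃L[ℝ] ℂ := Complex.equivRealProdCLM.symm

lemma toC_apply (p : Plane) : toC p = ⟨p.1, p.2⟩ := by
  apply Complex.ext <;> simp [toC]

/-- The space of ordered pairs of distinct points of the plane. -/
def distinctPairs : Set (Plane × Plane) := {p | p.1 ≠ p.2}

lemma isPreconnected_distinctPairs : IsPreconnected distinctPairs := by
  have hc : IsPreconnected ((univ : Set Plane) ×ˢ ({0}ᶜ : Set Plane)) :=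
    isPreconnected_univ.prod
      (isConnected_compl_singleton_of_one_lt_rank (by norm_num) (0 : Plane)).isPreconnected
  have himage := hc.image (fun p : Plane × Plane => (p.1, p.1 + p.2)) (by fun_prop)
  convert himage using 1
  ext ⟨x, y⟩
  constructor
  · intro h
    exact ⟨(x, y - x), ⟨mem_univ _, sub_ne_zero.2 (Ne.symm h)⟩, by simp⟩
  · rintro ⟨⟨a, b⟩, ⟨-, hb⟩, hab⟩
    obtain ⟨rfl, rfl⟩ := Prod.mk.inj hab
    exact fun h => hb (add_eq_left.1 (Eq.symm h))

lemma toC_sub_ne_zero {x y : Plane} (h : x ≠ y) : toC (y - x) ≠ 0 := by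
  simpa [sub_eq_zero] using h.symm

/-- Two continuous logarithms of the same function on a preconnected set differ by a constant. -/
lemma sub_const_of_exp_eq {X : Type*} [TopologicalSpace X] {S : Set X} (hS : IsPreconnected S)
    {A B : X → ℂ} (hA : ContinuousOn A S) (hB : ContinuousOn B S)
    (h : ∀ x ∈ S, Complex.exp (A x) = Complex.exp (B x)) {x y : X} (hx : x ∈ S) (hy : y ∈ S) :
    A x - B x = A y - B y := by
  have : PreconnectedSpace S := isPreconnected_iff_preconnectedSpace.1 hS
  have hc : Continuous fun z : S => A z - B z :=
    (continuousOn_iff_continuous_domRestrict.1 hA).sub (continuousOn_iff_continuous_domRestrict.1 hB)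
  have hexp : ∀ z : S, Complex.exp (A z - B z) = 1 := fun z => by
    rw [Complex.exp_sub, h z z.2, div_self (Complex.exp_ne_zero _)]
  exact IsSeparatedMap.const_of_comp (T2Space.isSeparatedMap _)
    Complex.isCoveringMap_exp.isLocalHomeomorph.isLocallyInjective hc
    (fun a b => Subtype.ext ((hexp a).trans (hexp b).symm)) ⟨x, hx⟩ ⟨y, hy⟩

/-- The logarithm of the variation of a homotopy of nonvanishing functions. -/
lemma exists_log_variation {X : Type*} [TopologicalSpace X] (K : unitInterval × X → ℂ)
    (hK : Continuous K) (h0 : ∀ p, K p ≠ 0) :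
    ∃ L : X → ℂ, Continuous L ∧ (∀ x, Complex.exp (L x) * K (0, x) = K (1, x)) ∧
      ∀ x, (∀ s, K (s, x) = K (0, x)) → L x = 0 := by
  let H : C(unitInterval × X, {z : ℂ // z ≠ 0}) :=
    ⟨fun p => ⟨K p / K (0, p.2), div_ne_zero (h0 _) (h0 _)⟩,
      (hK.div (by fun_prop) fun _ => h0 _).subtype_mk _⟩
  have H0 : ∀ x, H (0, x) = ⟨_, Complex.exp_ne_zero ((0 : C(X, ℂ)) x)⟩ := fun x =>
    Subtype.ext (by simp [H, h0])
  let M := Complex.isCoveringMap_exp.liftHomotopy H 0 H0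
  have hM : ∀ p, Complex.exp (M p) = K p / K (0, p.2) := fun p =>
    congrArg Subtype.val (congrFun (Complex.isCoveringMap_exp.liftHomotopy_lifts H 0 H0) p)
  have hM0 : ∀ x, M (0, x) = 0 := Complex.isCoveringMap_exp.liftHomotopy_zero H 0 H0
  refine ⟨fun x => M (1, x), by fun_prop, fun x => ?_, fun x hx => ?_⟩
  · rw [hM, div_mul_cancel₀ _ (h0 _)]
  · have := sub_const_of_exp_eq (A := fun s : unitInterval => M (s, x)) (B := fun _ => 0)
      isPreconnected_univ (by fun_prop) (by fun_prop)
      (fun s _ => by simp [hM, hx, h0]) (mem_univ 1) (mem_univ 0)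
    simpa [hM0] using this

/-- `W` is a continuous logarithm of the difference quotients `(h y - h x) / (y - x)`. -/
def IsLogQuotient (h : Plane → Plane) (W : Plane × Plane → ℂ) : Prop :=
  ContinuousOn W distinctPairs ∧
    ∀ x y, x ≠ y → Complex.exp (W (x, y)) * toC (y - x) = toC (h y - h x)

lemma exists_log_of_isotopy {F : ℝ × Plane → Plane} (hF : Continuous F)
    (hhomeo : ∀ t ∈ Icc (0:ℝ) 1, IsHomeoFun fun x => F (t, x)) :
    ∃ W : Plane × Plane → ℂ, ContinuousOn W distinctPairs ∧
      (∀ x y, x ≠ y → Complex.exp (W (x, y)) * toC (F (0, y) - F (0, x)) =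
        toC (F (1, y) - F (1, x))) ∧
      ∀ x y, x ≠ y → (∀ t ∈ Icc (0:ℝ) 1, F (t, x) = F (0, x) ∧ F (t, y) = F (0, y)) →
        W (x, y) = 0 := by
  classical
  obtain ⟨L, hL, hexp, hconst⟩ := exists_log_variation
    (fun p : unitInterval × distinctPairs => toC (F (p.1, p.2.1.2) - F (p.1, p.2.1.1)))
    (by fun_prop) (by
      rintro ⟨⟨t, ht⟩, ⟨x, y⟩, hxy⟩
      obtain ⟨e, he⟩ := hhomeo t ht
      refine toC_sub_ne_zero fun h => hxy (e.injective ?_)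
      rw [he, he]
      exact h)
  refine ⟨fun p => if h : p ∈ distinctPairs then L ⟨p, h⟩ else 0, ?_, fun x y hxy => ?_,
    fun x y hxy hc => ?_⟩
  · rw [continuousOn_iff_continuous_domRestrict]
    convert hL using 1
    ext ⟨p, hp⟩
    simp [hp]
  · have hp : (x, y) ∈ distinctPairs := hxy
    simpa [hp] using hexp ⟨_, hp⟩
  · have hp : (x, y) ∈ distinctPairs := hxy
    simp only [hp, dite_true]
    refine hconst ⟨_, hp⟩ fun s => ?_
    simp [(hc s s.2).1, (hc s s.2).2]

lemma OrientationPreserving.exists_isLogQuotient {h : Plane ≃ₜ Plane}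
    (hh : OrientationPreserving h) : ∃ W, IsLogQuotient h W := by
  obtain ⟨F, hF, hhomeo, h0, h1, -⟩ := hh
  obtain ⟨W, hW, hexp, -⟩ := exists_log_of_isotopy hF hhomeo
  exact ⟨W, hW, fun x y hxy => by simpa [h0, h1] using hexp x y hxy⟩

lemma IsLogQuotient.symm {h : Plane → Plane} {W : Plane × Plane → ℂ} (hW : IsLogQuotient h W)
    {x y : Plane} (hxy : x ≠ y) : W (x, y) = W (y, x) := by
  have hswap : MapsTo Prod.swap distinctPairs distinctPairs := fun p hp => Ne.symm hp
  have key := sub_const_of_exp_eq (A := W) (B := W ∘ Prod.swap) isPreconnected_distinctPairs hW.1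
    (hW.1.comp continuous_swap.continuousOn hswap) (fun p hp => ?_)
    (x := (x, y)) (y := (y, x)) hxy hxy.symm
  · simp only [Function.comp, Prod.swap_prod_mk] at key
    linear_combination key / 2
  · obtain ⟨a, b⟩ := p
    have hp' : a ≠ b := hp
    refine mul_right_cancel₀ (toC_sub_ne_zero hp') ?_
    simp only [Function.comp, Prod.swap_prod_mk]
    rw [hW.2 a b hp', ← neg_sub a b, map_neg, mul_neg, hW.2 b a hp'.symm, ← map_neg, neg_sub]

/-- Logarithms of the difference quotients based at two given points agree up to a bounded error
near infinity. -/
lemma IsLogQuotient.eventually_norm_sub_lt {h : Plane ≃ₜ Plane} {W : Plane × Plane → ℂ}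
    (hW : IsLogQuotient h W) (p q : Plane) :
    ∀ᶠ y in Filter.cocompact Plane, ‖W (p, y) - W (q, y)‖ < 1 := by
  have hquot : ∀ g : Plane ≃ₜ Plane, ∀ᶠ y in Filter.cocompact Plane, ∀ z ∈ segment ℝ p q,
      z ≠ y ∧ ‖toC (g y - g z) / toC (g y - g q) - 1‖ ≤ 1 / 4 := by
    intro g
    have hK : IsCompact (segment ℝ p q) := by
      rw [segment_eq_image]
      exact isCompact_Icc.image (by fun_prop)
    obtain ⟨R, hR⟩ := (hK.image (f := fun z => toC (g q - g z)) (by fun_prop)).isBounded.exists_norm_le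
    have ht : Filter.Tendsto (fun y => ‖toC (g y - g q)‖) (Filter.cocompact Plane)
        Filter.atTop := by
      have he : Topology.IsClosedEmbedding fun y => toC (g y - g q) :=
        ((g.trans (Homeomorph.subRight (g q))).trans toC.toHomeomorph).isClosedEmbedding
      exact tendsto_norm_cocompact_atTop.comp he.tendsto_cocompact
    filter_upwards [ht.eventually_ge_atTop (4 * R), ht.eventually_gt_atTop 0,
      hK.compl_mem_cocompact] with y hy hy0 hys z hz
    refine ⟨fun hzy => hys (hzy ▸ hz), ?_⟩
    have hne : toC (g y - g q) ≠ 0 := norm_pos_iff.1 hy0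
    have : toC (g y - g z) / toC (g y - g q) - 1 = toC (g q - g z) / toC (g y - g q) := by
      field_simp
      simp only [map_sub]
      ring
    rw [this, norm_div, div_le_iff₀ hy0]
    have := hR _ (mem_image_of_mem _ hz)
    linarith
  filter_upwards [hquot h, hquot (Homeomorph.refl _)] with y hy hy'
  have hsl : ∀ w : ℂ, ‖w - 1‖ ≤ 1 / 4 → w ∈ Complex.slitPlane := fun w hw => by
    have := Complex.mem_slitPlane_of_norm_lt_one (hw.trans_lt (by norm_num))
    simpa using this
  have hlog : ∀ w : ℂ, ‖w - 1‖ ≤ 1 / 4 → ‖Complex.log w‖ ≤ 3 / 8 := fun w hw => by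
    have := Complex.norm_log_one_add_half_le_self (hw.trans (by norm_num))
    rw [add_sub_cancel] at this
    linarith
  simp only [Homeomorph.refl_apply, id] at hy'
  have hqs : q ∈ segment ℝ p q := right_mem_segment ℝ p q
  have hps : p ∈ segment ℝ p q := left_mem_segment ℝ p q
  have key := sub_const_of_exp_eq (S := segment ℝ p q) (x := p) (y := q)
    (A := fun z => W (z, y) - W (q, y))
    (B := fun z => Complex.log (toC (h y - h z) / toC (h y - h q)) -
      Complex.log (toC (y - z) / toC (y - q)))
    (convex_segment p q).isPreconnected ?_ ?_ ?_ hps hqs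
  · have h1 : toC (h y - h q) ≠ 0 := toC_sub_ne_zero fun h' => (hy q hqs).1 (h.injective h')
    have h2 : toC (y - q) ≠ 0 := toC_sub_ne_zero (hy q hqs).1
    simp only [div_self h1, div_self h2, sub_self, Complex.log_one] at key
    rw [sub_eq_zero.1 key]
    have := norm_sub_le (Complex.log (toC (h y - h p) / toC (h y - h q)))
      (Complex.log (toC (y - p) / toC (y - q)))
    have := hlog _ (hy p hps).2
    have := hlog _ (hy' p hps).2
    linarith
  · exact (hW.1.comp (by fun_prop) fun z hz => (hy z hz).1).sub continuousOn_const
  · exact (ContinuousOn.clog (by fun_prop) fun z hz => hsl _ (hy z hz).2).sub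
      (ContinuousOn.clog (by fun_prop) fun z hz => hsl _ (hy' z hz).2)
  · intro z hz
    have hzy := (hy z hz).1
    have hqy := (hy q hqs).1
    have a1 := toC_sub_ne_zero hzy
    have a2 := toC_sub_ne_zero hqy
    have a3 := toC_sub_ne_zero (h.injective.ne hzy)
    have a4 := toC_sub_ne_zero (h.injective.ne hqy)
    rw [Complex.exp_sub, Complex.exp_sub, Complex.exp_log (div_ne_zero a3 a4),
      Complex.exp_log (div_ne_zero a1 a2), ← hW.2 z y hzy, ← hW.2 q y hqy]
    field_simp

lemma IsLogQuotient.comp {g h : Plane → Plane} {U W : Plane × Plane → ℂ} (hU : IsLogQuotient g U)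
    (hW : IsLogQuotient h W) (hh : Continuous h) (hi : Function.Injective h) :
    IsLogQuotient (g ∘ h) fun p => U (h p.1, h p.2) + W p := by
  refine ⟨(hU.1.comp (by fun_prop) fun p hp => hi.ne hp).add hW.1, fun x y hxy => ?_⟩
  rw [Complex.exp_add, mul_assoc, hW.2 x y hxy, hU.2 _ _ (hi.ne hxy)]
  rfl

lemma IsLogQuotient.exists_eq_add_const {h : Plane → Plane} {U W : Plane × Plane → ℂ}
    (hU : IsLogQuotient h U) (hW : IsLogQuotient h W) :
    ∃ C : ℂ, ∀ x y, x ≠ y → U (x, y) = W (x, y) + C := by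
  have h01 : ((0, 0), (1, 0)) ∈ distinctPairs := fun h => by simp at h
  refine ⟨U ((0, 0), (1, 0)) - W ((0, 0), (1, 0)), fun x y hxy => ?_⟩
  have hp : (x, y) ∈ distinctPairs := hxy
  rw [← sub_const_of_exp_eq isPreconnected_distinctPairs hU.1 hW.1
    (fun p hp => mul_right_cancel₀ (toC_sub_ne_zero hp)
      ((hU.2 p.1 p.2 hp).trans (hW.2 p.1 p.2 hp).symm)) hp h01]
  ring

/-- The principal logarithm of the difference quotients of `S`. -/
noncomputable def principalLog (S : Plane → Plane) (p : Plane × Plane) : ℂ :=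
  Complex.log (toC (S p.2 - S p.1) / toC (p.2 - p.1))

lemma isLogQuotient_principalLog {S : Plane ≃ₜ Plane} {c : ℝ} (hc : c ≠ 0)
    (hS : ∀ x y, S y - S x = y - x + (c * (y.2 - x.2), 0)) :
    IsLogQuotient S (principalLog S) := by
  refine ⟨ContinuousOn.clog (ContinuousOn.div (by fun_prop) (by fun_prop)
    fun p hp => toC_sub_ne_zero hp) fun p hp => ?_, fun x y hxy => ?_⟩
  · have h0 := toC_sub_ne_zero hp
    have hdiv : toC (S p.2 - S p.1) / toC (p.2 - p.1) =
        1 + ((c * (p.2.2 - p.1.2) : ℝ) : ℂ) / toC (p.2 - p.1) := by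
      rw [hS, map_add, add_div, div_self h0]
      congr 2
    rw [hdiv, Complex.mem_slitPlane_iff]
    rcases eq_or_ne (p.2.2 - p.1.2) 0 with hv | hv
    · left
      simp [hv]
    · right
      have him : (toC (p.2 - p.1)).im = p.2.2 - p.1.2 := by rw [toC_apply]; rfl
      have hn := Complex.normSq_pos.2 h0
      simp only [Complex.add_im, Complex.one_im, Complex.div_im, Complex.ofReal_im,
        Complex.ofReal_re, him]
      simp [hc, hv, hn.ne', -map_sub]
  · rw [principalLog, Complex.exp_log (div_ne_zero (toC_sub_ne_zero (S.injective.ne hxy))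
      (toC_sub_ne_zero hxy)), div_mul_cancel₀ _ (toC_sub_ne_zero hxy)]

lemma R₀_apply (x : Plane) : R₀ x = (x.1 + (3 - 2 * x.2), x.2) := rfl

lemma R₀_symm_apply (x : Plane) : R₀.symm x = (x.1 - (3 - 2 * x.2), x.2) := rfl

lemma isLogQuotient_R₀ : IsLogQuotient R₀ (principalLog R₀) :=
  isLogQuotient_principalLog (c := -2) (by norm_num) fun x y => by
    ext
    · simp [R₀_apply]
      ring
    · simp [R₀_apply]

lemma isLogQuotient_R₀_symm : IsLogQuotient R₀.symm (principalLog R₀.symm) :=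
  isLogQuotient_principalLog (c := 2) (by norm_num) fun x y => by
    ext
    · simp [R₀_symm_apply]
      ring
    · simp [R₀_symm_apply]

/-- An isotopy from `Ψ R₀ Ψ⁻¹` to `R₀⁻¹` relative to `O` compares the variations of angle along
`Ψ` before and after applying `R₀`. -/
lemma exists_const_of_isotopicRel_conjH {Ψ : Plane ≃ₜ Plane} {O : Set Plane}
    {W : Plane × Plane → ℂ} (hW : IsLogQuotient Ψ W)
    (h : IsotopicRel (conjH Ψ R₀) R₀.symm O) :
    ∃ C : ℂ, ∀ x y, x ≠ y → Ψ x ∈ O → Ψ y ∈ O →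
      W (R₀ x, R₀ y) + principalLog R₀ (x, y) =
        principalLog R₀.symm (Ψ x, Ψ y) + W (x, y) + C := by
  obtain ⟨G, hG, hhomeo, hG0, hG1, hGO⟩ := h
  obtain ⟨L, hL, hexp, hL0⟩ := exists_log_of_isotopy hG hhomeo
  have hA := hW.comp isLogQuotient_R₀ R₀.continuous R₀.injective
  have hA' : IsLogQuotient (R₀.symm ∘ Ψ) fun p => L (Ψ p.1, Ψ p.2) +
      (W (R₀ p.1, R₀ p.2) + principalLog R₀ p) := by
    refine ⟨(hL.comp (by fun_prop) fun p hp => Ψ.injective.ne hp).add hA.1, fun x y hxy => ?_⟩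
    rw [Complex.exp_add, mul_assoc, hA.2 x y hxy]
    have := hexp _ _ (Ψ.injective.ne hxy)
    simpa [hG0, hG1, conjH] using this
  have hB := isLogQuotient_R₀_symm.comp hW Ψ.continuous Ψ.injective
  obtain ⟨C, hC⟩ := hA'.exists_eq_add_const hB
  refine ⟨C, fun x y hxy hx hy => ?_⟩
  rw [← hC x y hxy, hL0 _ _ (Ψ.injective.ne hxy) fun t ht =>
    ⟨(hGO t ht _ hx).trans (hG0 _).symm, (hGO t ht _ hy).trans (hG0 _).symm⟩, zero_add]

lemma IsotopicRel.eqOn {g g' : Plane → Plane} {O : Set Plane} (h : IsotopicRel g g' O) :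
    EqOn g g' O := by
  obtain ⟨F, -, -, -, h1, hO⟩ := h
  exact fun x hx => (hO 1 (by simp) x hx).symm.trans (h1 x)

lemma eq_of_exp_eq_of_abs_im_sub_lt {a b : ℂ} (h : Complex.exp a = Complex.exp b)
    (hab : |a.im - b.im| < 2 * Real.pi) : a = b := by
  obtain ⟨n, hn⟩ := Complex.exp_eq_exp_iff_exists_int.1 h
  have him : a.im - b.im = n * (2 * Real.pi) := by simp [hn]
  have hn0 : n = 0 := by
    rw [him, abs_mul, abs_of_pos Real.two_pi_pos] at hab
    have : |(n : ℝ)| < 1 := by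
      by_contra! hcon
      nlinarith [Real.two_pi_pos]
    exact Int.abs_lt_one_iff.1 (by exact_mod_cast this)
  simpa [hn0] using hn

lemma eq_of_exp_eq_of_norm_sub_lt {a b : ℂ} (h : Complex.exp a = Complex.exp b)
    (hab : ‖a - b‖ < 1) : a = b := by
  refine eq_of_exp_eq_of_abs_im_sub_lt h ?_
  have := Complex.abs_im_le_norm (a - b)
  rw [Complex.sub_im] at this
  linarith [Real.pi_gt_three]

lemma ofReal_add_I_ne_zero (r : ℝ) : (r : ℂ) + Complex.I ≠ 0 := fun h => by
  simpa using congrArg Complex.im h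

lemma arg_ofReal_add_I_mem (r : ℝ) : ((r : ℂ) + Complex.I).arg ∈ Ico 0 Real.pi :=
  ⟨Complex.arg_nonneg_iff.2 (by simp), Complex.arg_lt_pi_iff.2 (by simp)⟩

lemma log_div_ofReal_add_I (r s : ℝ) :
    Complex.log ((r + Complex.I) / (s + Complex.I)) =
      Complex.log (r + Complex.I) - Complex.log (s + Complex.I) := by
  have hr := arg_ofReal_add_I_mem r
  have hs := arg_ofReal_add_I_mem s
  rw [← Complex.log_exp (x := Complex.log (r + Complex.I) - Complex.log (s + Complex.I)),
    Complex.exp_sub, Complex.exp_log (ofReal_add_I_ne_zero r),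
    Complex.exp_log (ofReal_add_I_ne_zero s)]
  · rw [Complex.sub_im, Complex.log_im, Complex.log_im]
    linarith [hr.1, hs.2]
  · rw [Complex.sub_im, Complex.log_im, Complex.log_im]
    linarith [hr.2, hs.1]

lemma exp_normalized_eq_one {u : ℂ} {d D : ℝ}
    (h : Complex.exp u * (d + Complex.I) = D + Complex.I) :
    Complex.exp (u + Complex.log (d + Complex.I) - Complex.log (D + Complex.I)) = 1 := by
  rw [Complex.exp_sub, Complex.exp_add, Complex.exp_log (ofReal_add_I_ne_zero d),
    Complex.exp_log (ofReal_add_I_ne_zero D), h, div_self (ofReal_add_I_ne_zero D)]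

lemma normalized_eq_add_pi {u w : ℂ} {d D : ℝ}
    (h : Complex.exp u * (d + Complex.I) = D + Complex.I) (hw : Complex.exp w = -1)
    (huw : ‖u - w‖ < 1) (hd : d < 0) (hD : 0 < D) :
    u + Complex.log (d + Complex.I) - Complex.log (D + Complex.I) = w + Real.pi * Complex.I := by
  refine eq_of_exp_eq_of_abs_im_sub_lt ?_ ?_
  · rw [exp_normalized_eq_one h, Complex.exp_add, hw, Complex.exp_pi_mul_I]
    norm_num
  · have h1 := (Complex.abs_im_le_norm (u - w)).trans_lt huw
    rw [Complex.sub_im, abs_lt] at h1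
    have h2 : ¬ |((d : ℂ) + Complex.I).arg| ≤ Real.pi / 2 := by
      rw [Complex.abs_arg_le_pi_div_two_iff]
      simpa using hd
    have h3 : |((D : ℂ) + Complex.I).arg| ≤ Real.pi / 2 := by
      rw [Complex.abs_arg_le_pi_div_two_iff]
      simpa using hD.le
    have h4 := arg_ofReal_add_I_mem d
    have h5 := arg_ofReal_add_I_mem D
    rw [abs_of_nonneg h4.1] at h2
    rw [abs_of_nonneg h5.1] at h3
    have him : ((Real.pi : ℂ) * Complex.I).im = Real.pi := by simp
    simp only [Complex.sub_im, Complex.add_im, Complex.log_im, him]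
    rw [abs_lt]
    constructor <;> linarith [h4.2, h5.1, Real.pi_gt_three]

lemma normalized_eq_sub_pi {u w : ℂ} {d D : ℝ}
    (h : Complex.exp u * (d + Complex.I) = D + Complex.I) (hw : Complex.exp w = -1)
    (huw : ‖u - w‖ < 1) (hd : 0 < d) (hD : D < 0) :
    u + Complex.log (d + Complex.I) - Complex.log (D + Complex.I) = w - Real.pi * Complex.I := by
  have h' : Complex.exp (-u) * (D + Complex.I) = d + Complex.I := by
    rw [← h, ← mul_assoc, ← Complex.exp_add, neg_add_cancel, Complex.exp_zero, one_mul]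
  have hw' : Complex.exp (-w) = -1 := by
    rw [Complex.exp_neg, hw]
    norm_num
  have huw' : ‖-u - -w‖ < 1 := by
    rwa [← norm_neg, show -(-u - -w) = u - w by ring]
  linear_combination -normalized_eq_add_pi h' hw' huw' hD hd

lemma eventually_atTop_of_cocompact {P : Plane → Prop}
    (hP : ∀ᶠ y in Filter.cocompact Plane, P y) {σ : ℕ → ℤ} (hσ : Function.Injective σ) (c : ℝ) :
    ∀ᶠ k : ℕ in Filter.atTop, P (σ k, c) := by
  have ht : Filter.Tendsto (fun k : ℕ => (((σ k : ℝ), c) : Plane)) Filter.atTop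
      (Filter.cocompact Plane) := by
    refine Filter.Tendsto.mono_right (Filter.tendsto_comap_iff.2 ?_)
      (Filter.comap_cocompact_le (continuous_fst : Continuous (Prod.fst : Plane → ℝ)))
    rw [← Nat.cofinite_eq_atTop]
    exact Int.tendsto_coe_cofinite.comp hσ.tendsto_cofinite
  exact ht.eventually hP

/-- An equivariant function on pairs of integers which is eventually independent of its first
variable is invariant. -/
lemma shift_const_eq_zero {w : ℤ → ℤ → ℂ} {C : ℂ} (hsymm : ∀ n m, n ≠ m → w n m = w m n)
    (hshift : ∀ n m, n ≠ m → w (n + 1) (m + 1) = w n m + C)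
    (hpos : ∀ᶠ k : ℕ in Filter.atTop, w 0 k = w 1 k)
    (hneg : ∀ᶠ k : ℕ in Filter.atTop, w 0 (-k) = w 1 (-k)) : C = 0 := by
  have hiter : ∀ (j : ℕ) (n m : ℤ), n ≠ m → w (n + j) (m + j) = w n m + j * C := by
    intro j n m hnm
    induction j with
    | zero => simp
    | succ j ih =>
      have := hshift (n + j) (m + j) (by simpa using hnm)
      push_cast
      rw [← add_assoc, ← add_assoc, this, ih]
      ring
  obtain ⟨k, h1, h2, hk⟩ := (((Filter.tendsto_add_atTop_nat 1).eventually hpos).and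
    (hneg.and (Filter.eventually_gt_atTop 0))).exists
  have hk' : (0 : ℤ) < k := by exact_mod_cast hk
  have e1 := hshift 0 k (by lia)
  have e2 := hshift 0 (-k - 1) (by lia)
  have e3 := hiter k 0 (-k) (by lia)
  have e4 := hiter (k + 1) 0 (-k - 1) (by lia)
  push_cast at h1 e4
  rw [show (-k - 1 + (k + 1) : ℤ) = 0 by ring, zero_add,
    hsymm _ _ (by lia)] at e4
  rw [show (-k + k : ℤ) = 0 by ring, zero_add, hsymm _ _ (by lia)] at e3
  rw [show (-k - 1 + 1 : ℤ) = -k by ring, zero_add] at e2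
  rw [zero_add] at e1
  linear_combination e4 - h1 - e1 - e3 - h2 - e2

/-- The lattice point `(n, c)`. -/
def latticePoint (c : ℝ) (n : ℤ) : Plane := (n, c)

lemma latticePoint_injective (c : ℝ) : Function.Injective (latticePoint c) := fun n m h => by
  simpa [latticePoint] using h

lemma latticePoint_one_ne_two (n m : ℤ) : latticePoint 1 n ≠ latticePoint 2 m := fun h => by
  simpa [latticePoint] using congrArg Prod.snd h

lemma R₀_latticePoint_one (n : ℤ) : R₀ (latticePoint 1 n) = latticePoint 1 (n + 1) := by
  ext <;> simp [R₀_apply, latticePoint]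
  norm_num

lemma R₀_latticePoint_two (n : ℤ) : R₀ (latticePoint 2 n) = latticePoint 2 (n - 1) := by
  ext <;> simp [R₀_apply, latticePoint]
  ring

lemma R₀_symm_latticePoint_one (n : ℤ) :
    R₀.symm (latticePoint 1 n) = latticePoint 1 (n - 1) := by
  rw [Homeomorph.symm_apply_eq, R₀_latticePoint_one, sub_add_cancel]

lemma R₀_symm_latticePoint_two (n : ℤ) :
    R₀.symm (latticePoint 2 n) = latticePoint 2 (n + 1) := by
  rw [Homeomorph.symm_apply_eq, R₀_latticePoint_two, add_sub_cancel_right]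

lemma principalLog_eq_zero {S : Plane → Plane} {x y : Plane} (hxy : x ≠ y)
    (h : S y - S x = y - x) : principalLog S (x, y) = 0 := by
  simp only [principalLog, h]
  rw [div_self (toC_sub_ne_zero hxy), Complex.log_one]

lemma toC_latticePoint_sub (c : ℝ) (n m : ℤ) :
    toC (latticePoint c m - latticePoint c n) = (m : ℂ) - n := by
  rw [toC_apply]
  apply Complex.ext <;> simp [latticePoint]

lemma toC_latticePoint_two_sub_one (n m : ℤ) :
    toC (latticePoint 2 m - latticePoint 1 n) = ((m - n : ℝ) : ℂ) + Complex.I := by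
  rw [toC_apply]
  apply Complex.ext <;> simp [latticePoint]
  norm_num

lemma IsLogQuotient.exp_latticePoint {Ψ : Plane → Plane} {W : Plane × Plane → ℂ}
    (hW : IsLogQuotient Ψ W) {c : ℝ} {a : ℤ}
    (ha : ∀ n, Ψ (latticePoint c n) = latticePoint c (a - n)) {n m : ℤ} (hnm : n ≠ m) :
    Complex.exp (W (latticePoint c n, latticePoint c m)) = -1 := by
  have h := hW.2 _ _ ((latticePoint_injective c).ne hnm)
  rw [ha, ha, toC_latticePoint_sub, toC_latticePoint_sub] at h
  have hne : (m : ℂ) - n ≠ 0 := sub_ne_zero.2 (by exact_mod_cast hnm.symm)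
  refine mul_right_cancel₀ hne (h.trans ?_)
  push_cast
  ring

lemma IsLogQuotient.exp_latticePoint_mixed {Ψ : Plane → Plane} {W : Plane × Plane → ℂ}
    (hW : IsLogQuotient Ψ W) {a b : ℤ}
    (ha : ∀ n, Ψ (latticePoint 1 n) = latticePoint 1 (a - n))
    (hb : ∀ n, Ψ (latticePoint 2 n) = latticePoint 2 (b - n)) (n m : ℤ) :
    Complex.exp (W (latticePoint 1 n, latticePoint 2 m)) * ((m - n : ℝ) + Complex.I) =
      ((b - a - (m - n) : ℝ) : ℂ) + Complex.I := by
  have h := hW.2 _ _ (latticePoint_one_ne_two n m)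
  rw [ha, hb, toC_latticePoint_two_sub_one, toC_latticePoint_two_sub_one] at h
  rw [h]
  push_cast
  ring

lemma IsLogQuotient.eventually_eq {Ψ : Plane ≃ₜ Plane} {W : Plane × Plane → ℂ}
    (hW : IsLogQuotient Ψ W) {c : ℝ} {a : ℤ}
    (ha : ∀ n, Ψ (latticePoint c n) = latticePoint c (a - n)) (n m : ℤ) {σ : ℕ → ℤ}
    (hσ : Function.Injective σ) : ∀ᶠ k : ℕ in Filter.atTop,
      W (latticePoint c n, latticePoint c (σ k)) = W (latticePoint c m, latticePoint c (σ k)) := by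
  have hne : ∀ j : ℤ, ∀ᶠ k in Filter.atTop, σ k ≠ j := fun j => by
    rw [← Nat.cofinite_eq_atTop]
    exact hσ.tendsto_cofinite.eventually (Filter.eventually_cofinite_ne j)
  filter_upwards [eventually_atTop_of_cocompact
    (hW.eventually_norm_sub_lt (latticePoint c n) (latticePoint c m)) hσ c, hne n, hne m]
    with k hk h1 h2
  refine eq_of_exp_eq_of_norm_sub_lt ?_ hk
  rw [hW.exp_latticePoint ha h1.symm, hW.exp_latticePoint ha h2.symm]

lemma exists_apply_latticePoint_eq_sub {Ψ : Plane ≃ₜ Plane} {c : ℝ}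
    (hZ : ∀ n, ∃ m, Ψ (latticePoint c n) = latticePoint c m)
    (hrev : ∀ n, latticePoint c (n + 1) + Ψ (latticePoint c (n + 1)) =
      latticePoint c n + Ψ (latticePoint c n)) :
    ∃ a : ℤ, ∀ n, Ψ (latticePoint c n) = latticePoint c (a - n) := by
  obtain ⟨a, ha⟩ := hZ 0
  have hsum : ∀ n : ℤ, latticePoint c n + Ψ (latticePoint c n) =
      latticePoint c 0 + Ψ (latticePoint c 0) := by
    intro n
    induction n using Int.induction_on with
    | zero => rfl
    | succ i ih => rw [hrev, ih]
    | pred i ih => rw [← hrev, sub_add_cancel, ih]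
  refine ⟨a, fun n => ?_⟩
  have := hsum n
  rw [ha, ← eq_sub_iff_add_eq'] at this
  rw [this]
  ext <;> simp [latticePoint]

lemma apply_latticePoint_mem {Ψ : Plane ≃ₜ Plane} {a b : ℤ}
    (ha : ∀ n, Ψ (latticePoint 1 n) = latticePoint 1 (a - n))
    (hb : ∀ n, Ψ (latticePoint 2 n) = latticePoint 2 (b - n)) (n : ℤ) :
    Ψ (latticePoint 1 n) ∈ Z1 ∪ Z2 ∧ Ψ (latticePoint 2 n) ∈ Z1 ∪ Z2 := by
  rw [ha, hb]
  exact ⟨Or.inl ⟨_, rfl⟩, Or.inr ⟨_, rfl⟩⟩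

/-- A homeomorphism conjugating the Reeb class to its inverse reverses both integer lines. -/
lemma exists_reversal {Ψ : Plane ≃ₜ Plane} (h1 : Ψ '' Z1 = Z1) (h2 : Ψ '' Z2 = Z2)
    (h : IsotopicRel (conjH Ψ R₀) R₀.symm (Z1 ∪ Z2)) :
    ∃ a b : ℤ, (∀ n, Ψ (latticePoint 1 n) = latticePoint 1 (a - n)) ∧
      ∀ n, Ψ (latticePoint 2 n) = latticePoint 2 (b - n) := by
  have hZ1 : ∀ n, ∃ m, Ψ (latticePoint 1 n) = latticePoint 1 m := fun n =>
    h1.subset (mem_image_of_mem Ψ ⟨n, rfl⟩)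
  have hZ2 : ∀ n, ∃ m, Ψ (latticePoint 2 n) = latticePoint 2 m := fun n =>
    h2.subset (mem_image_of_mem Ψ ⟨n, rfl⟩)
  have hcomm : ∀ x, Ψ x ∈ Z1 ∪ Z2 → Ψ (R₀ x) = R₀.symm (Ψ x) := fun x hx => by
    simpa [conjH] using h.eqOn hx
  obtain ⟨a, ha⟩ := exists_apply_latticePoint_eq_sub hZ1 fun n => by
    obtain ⟨m, hm⟩ := hZ1 n
    have := hcomm (latticePoint 1 n) (Or.inl ⟨m, hm⟩)
    rw [R₀_latticePoint_one, hm, R₀_symm_latticePoint_one] at this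
    rw [this, hm]
    ext <;> simp [latticePoint]
  obtain ⟨b, hb⟩ := exists_apply_latticePoint_eq_sub hZ2 fun n => by
    obtain ⟨m, hm⟩ := hZ2 (n + 1)
    have := hcomm (latticePoint 2 (n + 1)) (Or.inr ⟨m, hm⟩)
    rw [R₀_latticePoint_two, hm, R₀_symm_latticePoint_two, add_sub_cancel_right] at this
    rw [this, hm]
    ext <;> simp [latticePoint]
    ring
  exact ⟨a, b, ha, hb⟩

/-- The variation along `Ψ` of a pair of points on different lines, measured modulo full turns
with the principal arguments of the initial and final positions. -/
noncomputable def normalizedVariation (W : Plane × Plane → ℂ) (e n m : ℤ) : ℂ :=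
  W (latticePoint 1 n, latticePoint 2 m) + Complex.log ((m - n : ℝ) + Complex.I) -
    Complex.log ((e - (m - n) : ℝ) + Complex.I)

lemma normalizedVariation_shift {Ψ : Plane ≃ₜ Plane} {W : Plane × Plane → ℂ} {a b : ℤ}
    (ha : ∀ n, Ψ (latticePoint 1 n) = latticePoint 1 (a - n))
    (hb : ∀ n, Ψ (latticePoint 2 n) = latticePoint 2 (b - n))
    (hrel : ∀ n m, W (R₀ (latticePoint 1 n), R₀ (latticePoint 2 m)) +
      principalLog R₀ (latticePoint 1 n, latticePoint 2 m) =
        principalLog R₀.symm (Ψ (latticePoint 1 n), Ψ (latticePoint 2 m)) +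
          W (latticePoint 1 n, latticePoint 2 m)) (n m : ℤ) :
    normalizedVariation W (b - a) (n + 1) (m - 1) = normalizedVariation W (b - a) n m := by
  have h := hrel n m
  rw [principalLog, principalLog] at h
  simp only [ha, hb, R₀_latticePoint_one, R₀_latticePoint_two, R₀_symm_latticePoint_one,
    R₀_symm_latticePoint_two, toC_latticePoint_two_sub_one, log_div_ofReal_add_I] at h
  rw [normalizedVariation, normalizedVariation]
  push_cast at h ⊢
  ring_nf at h ⊢
  linear_combination h

lemma normalizedVariation_iterate {W : Plane × Plane → ℂ} {e : ℤ}
    (h : ∀ n m, normalizedVariation W e (n + 1) (m - 1) = normalizedVariation W e n m)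
    (j : ℕ) (n m : ℤ) :
    normalizedVariation W e (n + j) (m - j) = normalizedVariation W e n m := by
  induction j with
  | zero => simp
  | succ j ih =>
    rw [← ih, ← h (n + j) (m - j)]
    push_cast
    ring_nf

/-- For an equivariant symmetric function with no defect, the values at opposite far away
points agree. -/
lemma eq_neg_of_shift {w : ℤ → ℤ → ℂ} (hsymm : ∀ n m, n ≠ m → w n m = w m n)
    (hshift : ∀ n m, n ≠ m → w (n + 1) (m + 1) = w n m) {k : ℕ} (hk : 0 < k) :
    w 0 (-k) = w 0 k := by
  have hiter : ∀ j : ℕ, w (0 + j) (-k + j) = w 0 (-k) := by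
    intro j
    induction j with
    | zero => simp
    | succ j ih =>
      push_cast
      rw [← ih, ← add_assoc, ← add_assoc]
      exact hshift _ _ (by lia)
  rw [← hiter k, neg_add_cancel, zero_add]
  exact hsymm _ _ (by lia)

/-- The mapping class of the Reeb homeomorphism is not
conjugate to that of its inverse. -/
theorem reeb_not_conjugate_to_inverse :
    ¬ ∃ Ψ : Plane ≃ₜ Plane, OrientationPreserving Ψ ∧
        Ψ '' Z1 = Z1 ∧ Ψ '' Z2 = Z2 ∧
        IsotopicRel (⇑(conjH Ψ R₀)) (⇑R₀.symm) (Z1 ∪ Z2) := by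
  rintro ⟨Ψ, hΨ, h1, h2, h⟩
  obtain ⟨a, b, ha, hb⟩ := exists_reversal h1 h2 h
  obtain ⟨W, hW⟩ := hΨ.exists_isLogQuotient
  obtain ⟨C, hC⟩ := exists_const_of_isotopicRel_conjH hW h
  have hmem := apply_latticePoint_mem ha hb
  set w₁ : ℤ → ℤ → ℂ := fun n m => W (latticePoint 1 n, latticePoint 1 m) with hw₁
  set w₂ : ℤ → ℤ → ℂ := fun n m => W (latticePoint 2 n, latticePoint 2 m) with hw₂
  have hcast : Function.Injective fun k : ℕ => (k : ℤ) := Nat.cast_injective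
  have hncast : Function.Injective fun k : ℕ => -(k : ℤ) := fun k l hkl => by simpa using hkl
  have hsymm₁ : ∀ n m, n ≠ m → w₁ n m = w₁ m n := fun n m hnm =>
    hW.symm ((latticePoint_injective 1).ne hnm)
  have hsymm₂ : ∀ n m, n ≠ m → w₂ n m = w₂ m n := fun n m hnm =>
    hW.symm ((latticePoint_injective 2).ne hnm)
  have hshift₁ : ∀ n m, n ≠ m → w₁ (n + 1) (m + 1) = w₁ n m + C := by
    intro n m hnm
    have hne := (latticePoint_injective 1).ne hnm
    have := hC _ _ hne (hmem n).1 (hmem m).1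
    rw [principalLog_eq_zero hne, principalLog_eq_zero (Ψ.injective.ne hne),
      R₀_latticePoint_one, R₀_latticePoint_one, add_zero, zero_add] at this
    · exact this
    · rw [ha, ha, R₀_symm_latticePoint_one, R₀_symm_latticePoint_one]
      ext <;> simp [latticePoint]
    · rw [R₀_latticePoint_one, R₀_latticePoint_one]
      ext <;> simp [latticePoint]
  obtain rfl : C = 0 := shift_const_eq_zero hsymm₁ hshift₁ (hW.eventually_eq ha 0 1 hcast)
    (hW.eventually_eq ha 0 1 hncast)
  simp only [add_zero] at hC hshift₁
  have hshift₂ : ∀ n m, n ≠ m → w₂ (n + 1) (m + 1) = w₂ n m := by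
    intro n m hnm
    have hne := (latticePoint_injective 2).ne ((add_left_injective (1 : ℤ)).ne hnm)
    have := hC _ _ hne (hmem _).2 (hmem _).2
    rw [principalLog_eq_zero hne, principalLog_eq_zero (Ψ.injective.ne hne),
      R₀_latticePoint_two, R₀_latticePoint_two, add_zero, zero_add, add_sub_cancel_right,
      add_sub_cancel_right] at this
    · exact this.symm
    · rw [hb, hb, R₀_symm_latticePoint_two, R₀_symm_latticePoint_two]
      ext <;> simp [latticePoint]
    · rw [R₀_latticePoint_two, R₀_latticePoint_two]
      ext <;> simp [latticePoint]
  have hv := normalizedVariation_iterate (normalizedVariation_shift ha hb fun n m =>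
    hC _ _ (latticePoint_one_ne_two n m) (hmem n).1 (hmem m).2)
  have hmixed := hW.exp_latticePoint_mixed ha hb
  have near₁ := hW.eventually_norm_sub_lt (latticePoint 2 0) (latticePoint 1 0)
  have near₂ := hW.eventually_norm_sub_lt (latticePoint 1 0) (latticePoint 2 0)
  obtain ⟨k, n1, n2, n3, n4, hk⟩ := ((eventually_atTop_of_cocompact near₁ hcast 1).and
    ((eventually_atTop_of_cocompact near₁ hncast 1).and
    ((eventually_atTop_of_cocompact near₂ hcast 2).and
    ((eventually_atTop_of_cocompact near₂ hncast 2).and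
      (Filter.eventually_gt_atTop (b - a).natAbs))))).exists
  have hk0 : 0 < k := by lia
  have hkR : (0 : ℝ) < k := by exact_mod_cast hk0
  have hlt : ((b : ℝ) - a) < k := by
    exact_mod_cast (show b - a < (k : ℤ) by lia)
  have hgt : -(k : ℝ) < (b : ℝ) - a := by
    exact_mod_cast (show -(k : ℤ) < b - a by lia)
  have hk0' : (0 : ℤ) ≠ k := by lia
  have hk0'' : (0 : ℤ) ≠ -k := by lia
  have e1 := normalized_eq_add_pi (hmixed k 0) (hW.exp_latticePoint ha hk0')
    (by rw [hW.symm (latticePoint_one_ne_two k 0)]; exact n1)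
    (by push_cast; linarith) (by push_cast; linarith)
  have e2 := normalized_eq_sub_pi (hmixed (-k) 0) (hW.exp_latticePoint ha hk0'')
    (by rw [hW.symm (latticePoint_one_ne_two (-k) 0)]; exact n2)
    (by push_cast; linarith) (by push_cast; linarith)
  have e3 := normalized_eq_sub_pi (hmixed 0 k) (hW.exp_latticePoint hb hk0') n3
    (by push_cast; linarith) (by push_cast; linarith)
  have e4 := normalized_eq_add_pi (hmixed 0 (-k)) (hW.exp_latticePoint hb hk0'') n4
    (by push_cast; linarith) (by push_cast; linarith)
  have v1 := hv k 0 k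
  have v2 := hv k (-k) 0
  rw [zero_add, sub_self] at v1
  rw [neg_add_cancel, zero_sub] at v2
  simp only [normalizedVariation, Int.cast_sub] at v1 v2
  have r1 : w₁ 0 (-k) = w₁ 0 k := eq_neg_of_shift hsymm₁ hshift₁ hk0
  have r2 : w₂ 0 (-k) = w₂ 0 k := eq_neg_of_shift hsymm₂ hshift₂ hk0
  simp only [hw₁, hw₂] at r1 r2
  rw [e1, e3] at v1
  rw [e2, e4] at v2
  have hfinal : (4 * Real.pi : ℂ) * Complex.I = 0 := by
    linear_combination v1 + v2 + r1 - r2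
  simp [Real.pi_ne_zero] at hfinal
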